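/- arXiv:2302.07542 — 2 statements merged into one kernel-verified Lean document; each statement's English description precedes it below -/
import Mathlib

section
/- (Theorem: bounds on the effective mutation rate.) In the multi-locus Wright–Fisher graph setup, assume θ_u > 0 for all u ∈ V and that the integer N satisfies N ≥ 2 and N ≥ 4C² where C = max_{j,u,v} |γ^j_{uv}| (and N ≥ 2 if C ≤ 1). Then θ_min/(1 + 2L^{−1}(1+ln N)θ_min) ≤ θ̂_eff ≤ θ̂ ≤ θ_max. -/
/-- Scaled fixation factor: `ω_γ = 2γ/(1 − e^{−2γ})` for `γ ≠ 0`, and `ω_0 = 1`. -/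
noncomputable def omegaSel (γ : ℝ) : ℝ :=
  if γ = 0 then 1 else 2 * γ / (1 - Real.exp (-2 * γ))

/-- `K_γ = ω_γ ∫_0^1 (−ln y)(e^{−2γy} − e^{−2γ(1−y)}) dy`. -/
noncomputable def Ksel (γ : ℝ) : ℝ :=
  omegaSel γ *
    ∫ y in (0:ℝ)..1, (-Real.log y) * (Real.exp (-2 * γ * y) - Real.exp (-2 * γ * (1 - y)))

theorem aux_int (x : ℝ) (f : ℝ → ℝ) (hf : Continuous f) (a b : ℝ) :
    IntervalIntegrable (fun y => (-Real.log y) * f y) MeasureTheory.volume a b := by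
  have h : IntervalIntegrable (fun y => -Real.log y) MeasureTheory.volume a b :=
    (intervalIntegral.intervalIntegrable_log' (a := a) (b := b)).neg
  exact h.mul_continuousOn hf.continuousOn

theorem omega_pos (g : ℝ) : 0 < omegaSel g := by
  unfold omegaSel
  split_ifs with h
  · norm_num
  · rcases lt_or_gt_of_ne h with h | h
    · apply div_pos_of_neg_of_neg (by linarith)
      have : 1 < Real.exp (-2 * g) := Real.one_lt_exp_iff.2 (by linarith)
      linarith
    · apply div_pos (by linarith)
      have : Real.exp (-2 * g) < 1 := Real.exp_lt_one_iff.2 (by linarith)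
      linarith

theorem omega_neg (g : ℝ) : omegaSel g = omegaSel (-g) * Real.exp (2 * g) := by
  unfold omegaSel
  by_cases h : g = 0
  · simp [h]
  · have h' : -g ≠ 0 := neg_ne_zero.2 h
    rw [if_neg h, if_neg h']
    have e : Real.exp (-2 * g) = (Real.exp (2 * g))⁻¹ := by
      rw [← Real.exp_neg]; ring_nf
    have e2 : Real.exp (-2 * -g) = Real.exp (2 * g) := by ring_nf
    rw [e, e2]
    have hp := Real.exp_pos (2 * g)
    have h1 : Real.exp (2 * g) ≠ 1 := by
      rw [Ne, Real.exp_eq_one_iff]; intro h3; apply h; linarith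
    have h2 : 1 - Real.exp (2 * g) ≠ 0 := fun h3 => h1 (by linarith)
    have h3 : Real.exp (2 * g) - 1 ≠ 0 := fun h3 => h1 (by linarith)
    have h4 : 1 - (Real.exp (2 * g))⁻¹ = (Real.exp (2 * g) - 1) / Real.exp (2 * g) := by
      field_simp
    rw [h4]
    field_simp
    ring

theorem K_neg (g : ℝ) : Ksel (-g) = - Ksel g := by
  unfold Ksel
  rw [omega_neg g, mul_assoc, ← mul_neg,
    ← intervalIntegral.integral_const_mul (Real.exp (2 * g)), ← intervalIntegral.integral_neg]
  congr 1
  apply intervalIntegral.integral_congr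
  intro y _
  have e1 : Real.exp (-2 * -g * y) = Real.exp (2 * g) * Real.exp (-2 * g * (1 - y)) := by
    rw [← Real.exp_add]; ring_nf
  have e2 : Real.exp (-2 * -g * (1 - y)) = Real.exp (2 * g) * Real.exp (-2 * g * y) := by
    rw [← Real.exp_add]; ring_nf
  simp only [e1, e2]
  ring

theorem int_exp (g : ℝ) :
    ∫ y in (0:ℝ)..1, Real.exp (-2 * g * y) = (omegaSel g)⁻¹ := by
  unfold omegaSel
  split_ifs with h
  · simp [h]
  · have h2 : -2 * g ≠ 0 := by simpa using h
    rw [intervalIntegral.integral_comp_mul_left (fun y => Real.exp y) h2]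
    simp only [integral_exp, smul_eq_mul, mul_zero, mul_one, Real.exp_zero, inv_div]
    field_simp
    ring

theorem int_diff (g : ℝ) :
    ∫ y in (0:ℝ)..1, (Real.exp (-2 * g * y) - Real.exp (-2 * g * (1 - y))) = 0 := by
  rw [intervalIntegral.integral_sub (Continuous.intervalIntegrable (by fun_prop) _ _)
    (Continuous.intervalIntegrable (by fun_prop) _ _)]
  rw [intervalIntegral.integral_comp_sub_left (fun y => Real.exp (-2 * g * y))]
  simp

theorem K_nonneg (g : ℝ) (hg : 0 ≤ g) : 0 ≤ Ksel g := by
  unfold Ksel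
  apply mul_nonneg (omega_pos g).le
  have hc : Continuous fun y : ℝ => Real.exp (-2 * g * y) - Real.exp (-2 * g * (1 - y)) := by
    fun_prop
  have h : ∫ y in (0:ℝ)..1, (-Real.log y) * (Real.exp (-2 * g * y) - Real.exp (-2 * g * (1 - y)))
      = ∫ y in (0:ℝ)..1, ((-Real.log y) * (Real.exp (-2 * g * y) - Real.exp (-2 * g * (1 - y)))
        - Real.log 2 * (Real.exp (-2 * g * y) - Real.exp (-2 * g * (1 - y)))) := by
    rw [intervalIntegral.integral_sub (aux_int 0 _ hc _ _)
      (Continuous.intervalIntegrable (by fun_prop) _ _),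
      intervalIntegral.integral_const_mul, int_diff]
    simp
  rw [h]
  apply intervalIntegral.integral_nonneg_of_ae_restrict zero_le_one
  rw [Filter.EventuallyLE, MeasureTheory.ae_restrict_iff' measurableSet_Icc]
  have h0 : ∀ᵐ y : ℝ, y ≠ 0 := by simp [MeasureTheory.ae_iff]
  filter_upwards [h0] with y hy0 hy
  have hy' : 0 < y := lt_of_le_of_ne hy.1 hy0.symm
  have : (-Real.log y) * (Real.exp (-2 * g * y) - Real.exp (-2 * g * (1 - y)))
        - Real.log 2 * (Real.exp (-2 * g * y) - Real.exp (-2 * g * (1 - y)))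
      = (-Real.log (2 * y)) * (Real.exp (-2 * g * y) - Real.exp (-2 * g * (1 - y))) := by
    rw [Real.log_mul two_ne_zero hy0]; ring
  rw [this]
  rcases le_total (2 * y) 1 with h1 | h1
  · apply mul_nonneg
    · have := Real.log_nonpos (by linarith) h1
      linarith
    · rw [sub_nonneg, Real.exp_le_exp]
      nlinarith
  · apply mul_nonneg_of_nonpos_of_nonpos
    · have := Real.log_nonneg h1
      linarith
    · rw [sub_nonpos, Real.exp_le_exp]
      nlinarith

theorem omega_le (g : ℝ) (hg : 0 ≤ g) (M : ℝ) (h2 : 2 ≤ M) (hM : 4 * g ^ 2 ≤ M) :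
    omegaSel g ≤ M := by
  unfold omegaSel
  split_ifs with h
  · linarith
  · have hg' : 0 < g := lt_of_le_of_ne hg (Ne.symm h)
    have hq := Real.quadratic_le_exp_of_nonneg (x := 2 * g) (by linarith)
    have e : Real.exp (-2 * g) = (Real.exp (2 * g))⁻¹ := by
      rw [← Real.exp_neg]; ring_nf
    have hlt : Real.exp (-2 * g) < 1 := Real.exp_lt_one_iff.2 (by linarith)
    rw [div_le_iff₀ (by linarith)]
    have hle : Real.exp (-2 * g) ≤ (1 + 2 * g + (2 * g) ^ 2 / 2)⁻¹ := by
      rw [e]; exact inv_anti₀ (by positivity) hq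
    obtain ⟨x, hx⟩ : ∃ x, x = 2 * g := ⟨_, rfl⟩
    have hx0 : 0 < x := by linarith
    have hxM : x ^ 2 ≤ M := by rw [hx]; linarith
    rw [← hx] at hle ⊢
    have hpos : 0 < 1 + x + x ^ 2 / 2 := by positivity
    have key : x ≤ M * (1 - (1 + x + x ^ 2 / 2)⁻¹) := by
      have : 1 - (1 + x + x ^ 2 / 2)⁻¹ = (x + x ^ 2 / 2) / (1 + x + x ^ 2 / 2) := by
        field_simp; ring
      rw [this, ← mul_div_assoc, le_div_iff₀ hpos]
      have : 1 + x + x ^ 2 / 2 ≤ M * (1 + x / 2) := by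
        have : 0 ≤ (M - 2) * (1/2) + (M - x ^ 2) * (1/2) + (M - 2) * x / 2 := by
          have := mul_nonneg (sub_nonneg.2 h2) hx0.le
          linarith
        nlinarith
      nlinarith
    nlinarith

theorem K_le (g : ℝ) (hg : 0 ≤ g) (M : ℝ) (h2 : 2 ≤ M) (hM : 4 * g ^ 2 ≤ M) :
    Ksel g ≤ 1 + Real.log M := by
  have hM0 : 0 < M := by linarith
  have hw := omega_pos g
  have hMi : (M⁻¹ : ℝ) ≤ 1 := inv_le_one_of_one_le₀ (by linarith)
  have hMi0 : 0 < M⁻¹ := by positivity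
  have c1 : Continuous fun y : ℝ => Real.exp (-2 * g * y) := by fun_prop
  have c2 : Continuous fun y : ℝ => Real.exp (-2 * g * y) - Real.exp (-2 * g * (1 - y)) := by
    fun_prop
  have A : ∫ y in (0:ℝ)..1, (-Real.log y) * (Real.exp (-2 * g * y) - Real.exp (-2 * g * (1 - y)))
      ≤ ∫ y in (0:ℝ)..1, (-Real.log y) * Real.exp (-2 * g * y) := by
    apply intervalIntegral.integral_mono_on zero_le_one (aux_int 0 _ c2 _ _) (aux_int 0 _ c1 _ _)
    intro y hy
    have := Real.log_nonpos hy.1 hy.2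
    have := Real.exp_pos (-2 * g * (1 - y))
    nlinarith
  have hI : ∀ a b : ℝ, IntervalIntegrable (fun y => Real.log M * Real.exp (-2 * g * y))
      MeasureTheory.volume a b := fun a b => Continuous.intervalIntegrable (by fun_prop) _ _
  have hJ : IntervalIntegrable (fun y => -Real.log y - Real.log M)
      MeasureTheory.volume 0 M⁻¹ :=
    (intervalIntegral.intervalIntegrable_log').neg.sub (by simp)
  have B1 : ∫ y in (0:ℝ)..M⁻¹, (-Real.log y) * Real.exp (-2 * g * y)
      ≤ (∫ y in (0:ℝ)..M⁻¹, Real.log M * Real.exp (-2 * g * y)) +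
        ∫ y in (0:ℝ)..M⁻¹, (-Real.log y - Real.log M) := by
    rw [← intervalIntegral.integral_add (hI _ _) hJ]
    apply intervalIntegral.integral_mono_on_of_le_Ioo hMi0.le (aux_int 0 _ c1 _ _) ((hI _ _).add hJ)
    intro y hy
    have h1 : Real.log y ≤ - Real.log M := by
      rw [← Real.log_inv]; exact Real.log_le_log hy.1 hy.2.le
    have h3 : Real.exp (-2 * g * y) ≤ 1 := Real.exp_le_one_iff.2 (by nlinarith [hy.1])
    nlinarith
  have B2 : ∫ y in M⁻¹..1, (-Real.log y) * Real.exp (-2 * g * y)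
      ≤ ∫ y in M⁻¹..1, Real.log M * Real.exp (-2 * g * y) := by
    apply intervalIntegral.integral_mono_on hMi (aux_int 0 _ c1 _ _) (hI _ _)
    intro y hy
    have h1 : - Real.log M ≤ Real.log y := by
      rw [← Real.log_inv]; exact Real.log_le_log hMi0 hy.1
    have := Real.exp_pos (-2 * g * y)
    nlinarith
  have B3 : ∫ y in (0:ℝ)..M⁻¹, (-Real.log y - Real.log M) = M⁻¹ := by
    have hl : IntervalIntegrable (fun y => -Real.log y) MeasureTheory.volume 0 M⁻¹ :=
      (intervalIntegral.intervalIntegrable_log').neg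
    have hcst : IntervalIntegrable (fun _ : ℝ => Real.log M) MeasureTheory.volume 0 M⁻¹ := by simp
    rw [intervalIntegral.integral_sub hl hcst,
      intervalIntegral.integral_neg, integral_log]
    simp
  have S1 := intervalIntegral.integral_add_adjacent_intervals
    (aux_int 0 _ c1 0 M⁻¹) (aux_int 0 _ c1 M⁻¹ 1)
  have S2 := intervalIntegral.integral_add_adjacent_intervals (hI 0 M⁻¹) (hI M⁻¹ 1)
  have S3 : ∫ y in (0:ℝ)..1, Real.log M * Real.exp (-2 * g * y)
      = Real.log M * (omegaSel g)⁻¹ := by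
    rw [intervalIntegral.integral_const_mul, int_exp]
  have T : ∫ y in (0:ℝ)..1, (-Real.log y) * (Real.exp (-2 * g * y) - Real.exp (-2 * g * (1 - y)))
      ≤ Real.log M * (omegaSel g)⁻¹ + M⁻¹ := by linarith
  unfold Ksel
  calc _ ≤ omegaSel g * (Real.log M * (omegaSel g)⁻¹ + M⁻¹) :=
        mul_le_mul_of_nonneg_left T hw.le
    _ = Real.log M + omegaSel g / M := by field_simp
    _ ≤ _ := by
      have : omegaSel g / M ≤ 1 := (div_le_one hM0).2 (omega_le g hg M h2 hM)
      linarith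

theorem K_ge (g : ℝ) (M : ℝ) (h2 : 2 ≤ M) (hM : 4 * g ^ 2 ≤ M) :
    0 ≤ 1 + Real.log M + Ksel g := by
  have hl : 0 ≤ Real.log M := Real.log_nonneg (by linarith)
  rcases le_total 0 g with h | h
  · have := K_nonneg g h
    linarith
  · have := K_le (-g) (by linarith) M h2 (by simpa using hM)
    rw [K_neg] at this
    linarith

theorem pair_le (a b g : ℝ) (ha : 0 ≤ a) (h : a * omegaSel g = b * omegaSel (-g)) :
    a * Ksel g + b * Ksel (-g) ≤ 0 := by
  have hb : b = a * Real.exp (2 * g) := by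
    rw [omega_neg g] at h
    apply mul_right_cancel₀ (omega_pos (-g)).ne'
    linarith
  rw [K_neg, hb]
  have e : a * Ksel g + a * Real.exp (2 * g) * -Ksel g
      = -(a * ((Real.exp (2 * g) - 1) * Ksel g)) := by ring
  rw [e, neg_nonpos]
  apply mul_nonneg ha
  rcases le_total 0 g with h | h
  · exact mul_nonneg (sub_nonneg.2 (Real.one_le_exp (by linarith))) (K_nonneg g h)
  · have := K_nonneg (-g) (by linarith)
    rw [K_neg] at this
    exact mul_nonneg_of_nonpos_of_nonpos
      (sub_nonpos.2 (Real.exp_le_one_iff.2 (by linarith))) (by linarith)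

/-- Bounds on the effective mutation rate in the multi-locus Wright–Fisher graph model:
`θ_min/(1 + 2L⁻¹(1+ln N)θ_min) ≤ θ̂_eff ≤ θ̂ ≤ θ_max`. -/
theorem effective_mutation_rate_bounds {V : Type*} [Fintype V] [Nonempty V]
    (L N : ℕ) (hL : 1 ≤ L) (hN : 2 ≤ N)
    (θ : V → V → ℝ) (hθ : ∀ u v, 0 ≤ θ u v) (hθdiag : ∀ u, θ u u = 0)
    (hθpos : ∀ u, 0 < ∑ v, θ u v)
    (γ : Fin L → V → V → ℝ) (hγ : ∀ j u v, γ j u v = -γ j v u)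
    (η : Fin L → V → ℝ) (hη0 : ∀ j u, 0 ≤ η j u) (hη1 : ∀ j, ∑ u, η j u = 1)
    (hdb : ∀ j u v,
      η j u * θ u v * omegaSel (γ j u v) = η j v * θ v u * omegaSel (γ j v u))
    (C : ℝ) (hC : ∀ j u v, |γ j u v| ≤ C) (hNC : 4 * C ^ 2 ≤ (N : ℝ))
    (Ω : Fin L → ℝ)
    (hΩ : ∀ j, Ω j = 1 + (2 / L) *
      ∑ u, ∑ v, η j u * θ u v * (1 + Real.log N + Ksel (γ j u v)))
    (θhat : Fin L → ℝ) (hθhat : ∀ j, θhat j = ∑ u, η j u * (∑ v, θ u v))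
    (θbar θeff θmin θmax : ℝ)
    (hθbar : θbar = (1 / L) * ∑ j, θhat j)
    (hθeff : θeff = (1 / L) * ∑ j, θhat j / Ω j)
    (hθmin : IsLeast (Set.range fun u => ∑ v, θ u v) θmin)
    (hθmax : IsGreatest (Set.range fun u => ∑ v, θ u v) θmax) :
    θmin / (1 + 2 / L * (1 + Real.log N) * θmin) ≤ θeff ∧ θeff ≤ θbar ∧ θbar ≤ θmax := by
  have hL0 : (0:ℝ) < L := by exact_mod_cast hL
  have hN2 : (2:ℝ) ≤ N := by exact_mod_cast hN
  have hlog : 0 ≤ Real.log (N:ℝ) := Real.log_nonneg (by linarith)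
  have hγN : ∀ j u v, 4 * (γ j u v) ^ 2 ≤ (N:ℝ) := by
    intro j u v
    have h1 : (γ j u v) ^ 2 ≤ C ^ 2 := by
      rw [← sq_abs]; exact pow_le_pow_left₀ (abs_nonneg _) (hC j u v) 2
    linarith
  have hmin : ∀ u, θmin ≤ ∑ v, θ u v := fun u => hθmin.2 ⟨u, rfl⟩
  have hmax : ∀ u, ∑ v, θ u v ≤ θmax := fun u => hθmax.2 ⟨u, rfl⟩
  have hmin0 : 0 < θmin := by
    obtain ⟨u, hu⟩ := hθmin.1
    rw [← hu]; exact hθpos u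
  have hh1 : ∀ j, θmin ≤ θhat j := by
    intro j
    calc θmin = ∑ u, η j u * θmin := by rw [← Finset.sum_mul, hη1, one_mul]
      _ ≤ _ := by
        rw [hθhat]
        exact Finset.sum_le_sum fun u _ => mul_le_mul_of_nonneg_left (hmin u) (hη0 j u)
  have hh2 : ∀ j, θhat j ≤ θmax := by
    intro j
    calc θhat j ≤ ∑ u, η j u * θmax := by
          rw [hθhat]
          exact Finset.sum_le_sum fun u _ => mul_le_mul_of_nonneg_left (hmax u) (hη0 j u)
      _ = θmax := by rw [← Finset.sum_mul, hη1, one_mul]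
  have hK : ∀ j, ∑ u, ∑ v, η j u * θ u v * Ksel (γ j u v) ≤ 0 := by
    intro j
    have h1 : ∑ u, ∑ v, η j u * θ u v * Ksel (γ j u v)
        = ∑ u, ∑ v, η j v * θ v u * Ksel (γ j v u) := Finset.sum_comm
    have h2 : (∑ u, ∑ v, η j u * θ u v * Ksel (γ j u v))
        + ∑ u, ∑ v, η j v * θ v u * Ksel (γ j v u) ≤ 0 := by
      simp only [← Finset.sum_add_distrib]
      refine Finset.sum_nonpos fun u _ => Finset.sum_nonpos fun v _ => ?_
      have hd := hdb j u v
      rw [hγ j v u] at hd ⊢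
      exact pair_le _ _ _ (mul_nonneg (hη0 j u) (hθ u v)) hd
    linarith
  have hΩ1 : ∀ j, 1 ≤ Ω j := by
    intro j
    rw [hΩ]
    have : 0 ≤ ∑ u, ∑ v, η j u * θ u v * (1 + Real.log N + Ksel (γ j u v)) :=
      Finset.sum_nonneg fun u _ => Finset.sum_nonneg fun v _ =>
        mul_nonneg (mul_nonneg (hη0 j u) (hθ u v)) (K_ge _ _ hN2 (hγN j u v))
    have : 0 ≤ (2 / (L:ℝ)) * ∑ u, ∑ v, η j u * θ u v * (1 + Real.log N + Ksel (γ j u v)) :=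
      mul_nonneg (by positivity) this
    linarith
  have hΩ2 : ∀ j, Ω j ≤ 1 + 2 / L * (1 + Real.log N) * θhat j := by
    intro j
    have e : ∑ u, ∑ v, η j u * θ u v * (1 + Real.log N + Ksel (γ j u v))
        = (1 + Real.log N) * θhat j + ∑ u, ∑ v, η j u * θ u v * Ksel (γ j u v) := by
      rw [hθhat]
      simp only [Finset.mul_sum, ← Finset.sum_add_distrib]
      refine Finset.sum_congr rfl fun u _ => Finset.sum_congr rfl fun v _ => ?_
      ring
    rw [hΩ, e, mul_assoc (2 / (L:ℝ))]
    have h2L : 0 ≤ 2 / (L:ℝ) := by positivity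
    have := mul_le_mul_of_nonneg_left
      (by linarith [hK j] : (1 + Real.log N) * θhat j
        + ∑ u, ∑ v, η j u * θ u v * Ksel (γ j u v) ≤ (1 + Real.log N) * θhat j) h2L
    linarith
  refine ⟨?_, ?_, ?_⟩
  · have hc : 0 ≤ 2 / (L:ℝ) * (1 + Real.log N) := by positivity
    generalize 2 / (L:ℝ) * (1 + Real.log N) = c at hc hΩ2
    have key : ∀ j, θmin / (1 + c * θmin) ≤ θhat j / Ω j := by
      intro j
      have h1 := hh1 j
      have hp : 0 < Ω j := by linarith [hΩ1 j]
      rw [div_le_div_iff₀ (by positivity) hp]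
      have := mul_le_mul_of_nonneg_left (hΩ2 j) hmin0.le
      nlinarith
    have := Finset.sum_le_sum fun j (_ : j ∈ Finset.univ) => key j
    rw [Finset.sum_const, Finset.card_univ, Fintype.card_fin, nsmul_eq_mul] at this
    rw [hθeff, one_div, ← div_eq_inv_mul, le_div_iff₀ hL0]
    linarith
  · rw [hθeff, hθbar]
    apply mul_le_mul_of_nonneg_left _ (by positivity)
    exact Finset.sum_le_sum fun j _ => div_le_self (by linarith [hh1 j]) (hΩ1 j)
  · have := Finset.sum_le_sum fun j (_ : j ∈ Finset.univ) => hh2 j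
    rw [Finset.sum_const, Finset.card_univ, Fintype.card_fin, nsmul_eq_mul] at this
    rw [hθbar, one_div, ← div_eq_inv_mul, div_le_iff₀ hL0]
    linarith
end

section
/- (Theorem: upper bound for allele frequency functionals.) In the multi-locus Wright–Fisher graph setup, assume the integer N satisfies N ≥ 2 and N ≥ 4C² where C = max_{j,u,v} |γ^j_{uv}|, and let f : (0,1) → ℝ be measurable and nonnegative with ∫_{1/N}^1 f(y)/y dy < ∞. Then ∑_{j=1}^L ∑_{u,v ∈ V} (2 η^j_u θ_{uv}/(L Ω^j_N)) ∫_{1/N}^1 (f(y)/y) · ω_{γ^j_{uv}} J_{γ^j_{uv}}(y) dy ≤ 2 θ̂_eff ∫_{1/N}^1 (f(y)/y) dy ≤ 2 θ̂ ∫_{1/N}^1 (f(y)/y) dy, where J_γ(y) = (1 − e^{−2γ(1−y)})/(2γ(1−y)) for γ ≠ 0 and J_0(y) = 1. -/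
/-- `J_γ(y) = (1 − e^{−2γ(1−y)})/(2γ(1−y))` for `γ ≠ 0`, and `J_0(y) = 1`. -/
noncomputable def Jfun (γ y : ℝ) : ℝ :=
  if γ = 0 then 1 else (1 - Real.exp (-2 * γ * (1 - y))) / (2 * γ * (1 - y))

theorem aux_omega_pos (γ : ℝ) : 0 < omegaSel γ := by
  unfold omegaSel
  split_ifs with h
  · exact one_pos
  · rcases lt_or_gt_of_ne h with h | h
    · apply div_pos_of_neg_of_neg (by linarith)
      have : 1 < Real.exp (-2 * γ) := Real.one_lt_exp_iff.2 (by linarith)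
      linarith
    · apply div_pos (by linarith)
      have : Real.exp (-2 * γ) < 1 := Real.exp_lt_one_iff.2 (by linarith)
      linarith

theorem aux_omega_inv (γ : ℝ) (h : γ ≠ 0) :
    1 / omegaSel γ + 1 / omegaSel (-γ) = 2 * (Real.sinh (2 * γ) / (2 * γ)) := by
  unfold omegaSel
  rw [if_neg h, if_neg (neg_ne_zero.2 h), one_div_div, one_div_div, Real.sinh_eq]
  have e1 : -2 * -γ = 2 * γ := by ring
  have e2 : -2 * γ = -(2 * γ) := by ring
  rw [e1, e2]
  field_simp
  ring

theorem aux_sinh (x t : ℝ) (hx : 0 ≤ x) (ht : 0 ≤ t) (ht1 : t ≤ 1) :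
    Real.sinh (x * t) ≤ t * Real.sinh x := by
  have hc : ConvexOn ℝ (Set.Ici (0:ℝ)) Real.sinh := by
    apply MonotoneOn.convexOn_of_deriv (convex_Ici 0) Real.continuous_sinh.continuousOn
      Real.differentiable_sinh.differentiableOn
    rw [Real.deriv_sinh]
    intro a ha b hb hab
    simp only [interior_Ici, Set.mem_Ioi] at ha hb
    rw [Real.cosh_le_cosh, abs_of_pos ha, abs_of_pos hb]
    exact hab
  have := hc.2 (Set.mem_Ici.2 hx) (Set.mem_Ici.2 le_rfl) ht (sub_nonneg.2 ht1) (by ring)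
  simpa [mul_comm] using this

theorem aux_J_nonneg (γ y : ℝ) (hy : y ≤ 1) : 0 ≤ Jfun γ y := by
  unfold Jfun
  split_ifs with h
  · exact zero_le_one
  · have e2 : -2 * γ * (1 - y) = -(2 * γ * (1 - y)) := by ring
    rw [e2]
    generalize 2 * γ * (1 - y) = x
    rcases le_total x 0 with h | h
    · apply div_nonneg_of_nonpos _ h
      have : 1 ≤ Real.exp (-x) := Real.one_le_exp (by linarith)
      linarith
    · apply div_nonneg _ h
      have : Real.exp (-x) ≤ 1 := Real.exp_le_one_iff.2 (by linarith)
      linarith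

theorem aux_J_le (γ y : ℝ) (hy0 : 0 ≤ y) (hy : y ≤ 1) :
    Jfun γ y + Jfun (-γ) y ≤ 1 / omegaSel γ + 1 / omegaSel (-γ) := by
  by_cases h : γ = 0
  · subst h; simp [Jfun, omegaSel]
  rw [aux_omega_inv γ h]
  have e : Jfun γ y + Jfun (-γ) y
      = 2 * (Real.sinh (2 * γ * (1 - y)) / (2 * γ * (1 - y))) := by
    unfold Jfun
    rw [if_neg h, if_neg (neg_ne_zero.2 h), Real.sinh_eq]
    have e1 : -2 * -γ * (1 - y) = 2 * γ * (1 - y) := by ring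
    have e2 : -2 * γ * (1 - y) = -(2 * γ * (1 - y)) := by ring
    have e3 : 2 * -γ * (1 - y) = -(2 * γ * (1 - y)) := by ring
    rw [e1, e2, e3, div_neg]
    ring
  rw [e]
  have key : ∀ g : ℝ, 0 < g → Real.sinh (g * (1 - y)) / (g * (1 - y)) ≤ Real.sinh g / g := by
    intro g hg
    have h0 : 0 ≤ Real.sinh g := Real.sinh_nonneg_iff.2 hg.le
    rcases eq_or_lt_of_le hy with h1 | h1
    · subst h1; simp; positivity
    · have h2 : 0 < 1 - y := by linarith
      rw [div_le_div_iff₀ (by positivity) hg]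
      have := aux_sinh g (1 - y) hg.le h2.le (by linarith)
      nlinarith
  rcases lt_or_gt_of_ne h with h | h
  · have := key (-(2 * γ)) (by linarith)
    rw [neg_mul, Real.sinh_neg, Real.sinh_neg, neg_div_neg_eq, neg_div_neg_eq] at this
    linarith
  · have := key (2 * γ) (by linarith)
    linarith

theorem aux_cosh (g : ℝ) : Real.cosh g - 1 ≤ g * Real.sinh g := by
  rw [Real.cosh_eq, Real.sinh_eq]
  have h1 := Real.add_one_le_exp g
  have h2 := Real.add_one_le_exp (-g)
  have h3 : Real.exp g * Real.exp (-g) = 1 := by rw [← Real.exp_add]; simp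
  have h4 := Real.exp_pos g
  have h5 := Real.exp_pos (-g)
  nlinarith [mul_le_mul_of_nonneg_left h1 h5.le, mul_le_mul_of_nonneg_left h2 h4.le]

theorem aux_log_int (g : ℝ → ℝ) (hg : Continuous g) (a b : ℝ) :
    IntervalIntegrable (fun y => (-Real.log y) * g y) MeasureTheory.volume a b := by
  have h : IntervalIntegrable (fun y => -Real.log y) MeasureTheory.volume a b :=
    intervalIntegral.intervalIntegrable_log'.neg
  exact h.mul_continuousOn hg.continuousOn

theorem aux_M (g : ℝ) (hg : g ≠ 0) (N : ℝ) (hN : 1 ≤ N) (hgN : g ^ 2 ≤ N) :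
    ∫ y in (0:ℝ)..1, (-Real.log y) * (Real.cosh (g * (1 - y)) - Real.cosh (g * y))
      ≤ (Real.sinh g / g) * (1 + Real.log N) := by
  have hN0 : 0 < N := by linarith
  have hd1 : 1 / N ≤ 1 := by rw [div_le_one hN0]; exact hN
  have hd0 : 0 < 1 / N := by positivity
  have hlN : 0 ≤ Real.log N := Real.log_nonneg hN
  have hch : Continuous fun y : ℝ => Real.cosh (g * (1 - y)) - Real.cosh (g * y) :=
    (Real.continuous_cosh.comp (by fun_prop)).sub (Real.continuous_cosh.comp (by fun_prop))
  have hcc : Continuous fun y : ℝ => Real.log N * Real.cosh (g * (1 - y)) :=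
    continuous_const.mul (Real.continuous_cosh.comp (by fun_prop))
  have hl : ∀ a b : ℝ, IntervalIntegrable (fun y => (-Real.log y - Real.log N) *
      (Real.cosh g - 1)) MeasureTheory.volume a b := fun a b =>
    ((intervalIntegral.intervalIntegrable_log'.neg).sub intervalIntegrable_const).mul_const _
  have I1 : ∫ y in (0:ℝ)..(1/N), (-Real.log y) * (Real.cosh (g * (1 - y)) - Real.cosh (g * y))
      ≤ ∫ y in (0:ℝ)..(1/N), (Real.log N * Real.cosh (g * (1 - y))
        + (-Real.log y - Real.log N) * (Real.cosh g - 1)) := by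
    apply intervalIntegral.integral_mono_on_of_le_Ioo hd0.le (aux_log_int _ hch _ _)
      ((hcc.intervalIntegrable _ _).add (hl _ _))
    intro y hy
    have hy1 : y ≤ 1 := hy.2.le.trans hd1
    have h1 : Real.log N ≤ -Real.log y := by
      have := Real.log_le_log hy.1 hy.2.le
      rw [one_div, Real.log_inv] at this
      linarith
    have h2 : Real.cosh (g * (1 - y)) ≤ Real.cosh g := by
      rw [Real.cosh_le_cosh, abs_mul]
      apply mul_le_of_le_one_right (abs_nonneg _)
      rw [abs_of_nonneg (by linarith)]; linarith [hy.1]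
    have h3 := Real.one_le_cosh (g * y)
    have h4 := Real.cosh_pos (g * y)
    nlinarith [mul_nonneg (sub_nonneg.2 h1) (sub_nonneg.2 h2), mul_nonneg (sub_nonneg.2 h1) (sub_nonneg.2 h3), mul_nonneg hlN h4.le]
  have I2 : ∫ y in (1/N)..(1:ℝ), (-Real.log y) * (Real.cosh (g * (1 - y)) - Real.cosh (g * y))
      ≤ ∫ y in (1/N)..(1:ℝ), Real.log N * Real.cosh (g * (1 - y)) := by
    apply intervalIntegral.integral_mono_on_of_le_Ioo hd1 (aux_log_int _ hch _ _)
      (hcc.intervalIntegrable _ _)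
    intro y hy
    have hy0 : 0 < y := hd0.trans hy.1
    have h1 : -Real.log y ≤ Real.log N := by
      have := Real.log_le_log hd0 hy.1.le
      rw [one_div, Real.log_inv] at this
      linarith
    have h0 : 0 ≤ -Real.log y := by
      have := Real.log_nonpos hy0.le hy.2.le
      linarith
    have h3 := Real.cosh_pos (g * (1 - y))
    have h4 := Real.cosh_pos (g * y)
    nlinarith [mul_nonneg (sub_nonneg.2 h1) h3.le, mul_nonneg h0 h4.le]
  rw [intervalIntegral.integral_add (hcc.intervalIntegrable _ _) (hl _ _)] at I1
  have E1 : ∫ y in (0:ℝ)..(1/N), (-Real.log y - Real.log N) * (Real.cosh g - 1)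
      = (Real.cosh g - 1) / N := by
    have hnl : IntervalIntegrable (fun y => -Real.log y) MeasureTheory.volume 0 (1 / N) :=
      intervalIntegral.intervalIntegrable_log'.neg
    rw [intervalIntegral.integral_mul_const, intervalIntegral.integral_sub
      hnl intervalIntegrable_const,
      intervalIntegral.integral_neg, integral_log, intervalIntegral.integral_const]
    simp only [one_div, Real.log_inv, smul_eq_mul]
    simp
    ring
  have E2 : ∫ y in (0:ℝ)..1, Real.log N * Real.cosh (g * (1 - y))
      = Real.log N * (Real.sinh g / g) := by
    rw [intervalIntegral.integral_const_mul]
    congr 1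
    have hder : ∀ y ∈ Set.uIcc (0:ℝ) 1,
        HasDerivAt (fun y => -(Real.sinh (g * (1 - y)) / g)) (Real.cosh (g * (1 - y))) y := by
      intro y _
      have h1 : HasDerivAt (fun y : ℝ => g * (1 - y)) (g * (-1)) y :=
        ((hasDerivAt_id y).const_sub 1).const_mul g
      have h2 := (h1.sinh.div_const g).neg
      have e : -(Real.cosh (g * (1 - y)) * (g * -1) / g) = Real.cosh (g * (1 - y)) := by
        field_simp
      rw [e] at h2
      exact h2
    rw [intervalIntegral.integral_eq_sub_of_hasDerivAt hder
      ((Real.continuous_cosh.comp (by fun_prop)).intervalIntegrable _ _)]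
    simp
  have A1 := intervalIntegral.integral_add_adjacent_intervals
    (aux_log_int _ hch 0 (1/N)) (aux_log_int _ hch (1/N) 1)
  have A2 := intervalIntegral.integral_add_adjacent_intervals
    (hcc.intervalIntegrable (μ := MeasureTheory.volume) 0 (1/N)) (hcc.intervalIntegrable (1/N) 1)
  have B : (Real.cosh g - 1) / N ≤ Real.sinh g / g := by
    have hc := aux_cosh g
    have hg2 : 0 < g ^ 2 := by positivity
    have h1 := Real.one_le_cosh g
    calc (Real.cosh g - 1) / N ≤ (Real.cosh g - 1) / g ^ 2 := by
          apply div_le_div_of_nonneg_left (by linarith) hg2 hgN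
      _ ≤ g * Real.sinh g / g ^ 2 := by gcongr
      _ = Real.sinh g / g := by field_simp
  linarith

theorem aux_K (γ : ℝ) (N : ℝ) (hN : 1 ≤ N) (hgN : 4 * γ ^ 2 ≤ N) :
    0 ≤ 1 / omegaSel γ * (1 + Real.log N + Ksel γ)
      + 1 / omegaSel (-γ) * (1 + Real.log N + Ksel (-γ)) := by
  have hlN : 0 ≤ Real.log N := Real.log_nonneg hN
  by_cases h : γ = 0
  · subst h; simp [Ksel, omegaSel]; linarith
  have hM := aux_M (2 * γ) (by simpa using h) N hN (by nlinarith)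
  have w1 := (aux_omega_pos γ).ne'
  have w2 := (aux_omega_pos (-γ)).ne'
  have hc : ∀ c : ℝ, Continuous fun y : ℝ =>
      Real.exp (-2 * c * y) - Real.exp (-2 * c * (1 - y)) := fun c => by fun_prop
  have hI : (∫ y in (0:ℝ)..1, (-Real.log y) * (Real.exp (-2 * γ * y) - Real.exp (-2 * γ * (1 - y))))
      + (∫ y in (0:ℝ)..1, (-Real.log y) * (Real.exp (-2 * -γ * y) - Real.exp (-2 * -γ * (1 - y))))
      = -2 * ∫ y in (0:ℝ)..1, (-Real.log y) *
        (Real.cosh (2 * γ * (1 - y)) - Real.cosh (2 * γ * y)) := by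
    rw [← intervalIntegral.integral_add (aux_log_int _ (hc γ) _ _) (aux_log_int _ (hc (-γ)) _ _),
      ← intervalIntegral.integral_const_mul]
    congr 1
    ext y
    rw [Real.cosh_eq, Real.cosh_eq]
    have e1 : -2 * -γ * y = 2 * γ * y := by ring
    have e2 : -2 * -γ * (1 - y) = 2 * γ * (1 - y) := by ring
    have e3 : -2 * γ * y = -(2 * γ * y) := by ring
    have e4 : -2 * γ * (1 - y) = -(2 * γ * (1 - y)) := by ring
    rw [e1, e2, e3, e4]
    ring
  have hw := aux_omega_inv γ h
  have : 1 / omegaSel γ * (1 + Real.log N + Ksel γ)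
      + 1 / omegaSel (-γ) * (1 + Real.log N + Ksel (-γ))
      = (1 / omegaSel γ + 1 / omegaSel (-γ)) * (1 + Real.log N)
      + ((∫ y in (0:ℝ)..1, (-Real.log y) * (Real.exp (-2 * γ * y) - Real.exp (-2 * γ * (1 - y))))
      + (∫ y in (0:ℝ)..1, (-Real.log y) * (Real.exp (-2 * -γ * y) - Real.exp (-2 * -γ * (1 - y))))) := by
    unfold Ksel
    field_simp
    ring
  rw [this, hI, hw]
  linarith

theorem aux_sym {V : Type*} [Fintype V] (G : V → V → ℝ) (h : ∀ u v, 0 ≤ G u v + G v u) :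
    0 ≤ ∑ u, ∑ v, G u v := by
  have h1 : 0 ≤ ∑ u, ∑ v, (G u v + G v u) :=
    Finset.sum_nonneg fun u _ => Finset.sum_nonneg fun v _ => h u v
  simp only [Finset.sum_add_distrib] at h1
  rw [Finset.sum_comm (f := fun u v => G v u)] at h1
  linarith

theorem aux_J_int (F : ℝ → ℝ) (a : ℝ) (ha0 : 0 ≤ a) (ha : a ≤ 1)
    (hF : IntervalIntegrable F MeasureTheory.volume a 1) (γ : ℝ) :
    IntervalIntegrable (fun y => F y * Jfun γ y) MeasureTheory.volume a 1 := by
  rw [intervalIntegrable_iff_integrableOn_Ioc_of_le ha] at hF ⊢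
  have hm : Measurable (Jfun γ) := by
    unfold Jfun
    split_ifs
    · exact measurable_const
    · fun_prop
  refine MeasureTheory.Integrable.mul_bdd (c := 1 / omegaSel γ + 1 / omegaSel (-γ)) hF
    hm.aestronglyMeasurable ?_
  rw [MeasureTheory.ae_restrict_iff' measurableSet_Ioc]
  refine Filter.Eventually.of_forall fun y hy => ?_
  have h1 := aux_J_nonneg γ y hy.2
  have h2 := aux_J_nonneg (-γ) y hy.2
  rw [Real.norm_of_nonneg h1]
  linarith [aux_J_le γ y (by linarith [hy.1]) hy.2]

/-- Upper bound for allele frequency functionals: the expected value of a nonnegative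
frequency functional `f` over polymorphic states is bounded by
`2 θ̂_eff ∫_{1/N}^1 f(y)/y dy ≤ 2 θ̂ ∫_{1/N}^1 f(y)/y dy`. -/
theorem allele_frequency_functional_upper_bound {V : Type*} [Fintype V]
    (L N : ℕ) (hL : 1 ≤ L) (hN : 2 ≤ N)
    (θ : V → V → ℝ) (hθ : ∀ u v, 0 ≤ θ u v) (hθdiag : ∀ u, θ u u = 0)
    (γ : Fin L → V → V → ℝ) (hγ : ∀ j u v, γ j u v = -γ j v u)
    (η : Fin L → V → ℝ) (hη0 : ∀ j u, 0 ≤ η j u) (hη1 : ∀ j, ∑ u, η j u = 1)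
    (hdb : ∀ j u v,
      η j u * θ u v * omegaSel (γ j u v) = η j v * θ v u * omegaSel (γ j v u))
    (C : ℝ) (hC : ∀ j u v, |γ j u v| ≤ C) (hNC : 4 * C ^ 2 ≤ (N : ℝ))
    (Ω : Fin L → ℝ)
    (hΩ : ∀ j, Ω j = 1 + (2 / L) *
      ∑ u, ∑ v, η j u * θ u v * (1 + Real.log N + Ksel (γ j u v)))
    (θhat : Fin L → ℝ) (hθhat : ∀ j, θhat j = ∑ u, η j u * (∑ v, θ u v))
    (θbar θeff : ℝ)
    (hθbar : θbar = (1 / L) * ∑ j, θhat j)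
    (hθeff : θeff = (1 / L) * ∑ j, θhat j / Ω j)
    (f : ℝ → ℝ) (hfmeas : Measurable f) (hfnonneg : ∀ y ∈ Set.Ioo (0:ℝ) 1, 0 ≤ f y)
    (hfint : IntervalIntegrable (fun y => f y / y) MeasureTheory.volume (1 / N) 1) :
    (∑ j, ∑ u, ∑ v, (2 * η j u * θ u v / (L * Ω j)) *
        ∫ y in (1 / N : ℝ)..1, (f y / y) * (omegaSel (γ j u v) * Jfun (γ j u v) y))
      ≤ 2 * θeff * ∫ y in (1 / N : ℝ)..1, f y / y ∧
    2 * θeff * (∫ y in (1 / N : ℝ)..1, f y / y)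
      ≤ 2 * θbar * ∫ y in (1 / N : ℝ)..1, f y / y := by
  have hLr : (0:ℝ) < L := by exact_mod_cast hL
  have hNr : (1:ℝ) ≤ N := by exact_mod_cast (by omega : 1 ≤ N)
  have ha0 : (0:ℝ) ≤ 1 / N := by positivity
  have ha1 : (1 / N : ℝ) ≤ 1 := by rw [div_le_one (by linarith)]; exact hNr
  set F : ℝ := ∫ y in (1 / N : ℝ)..1, f y / y with hF
  have hpt : ∀ y ∈ Set.Ioo (1 / N : ℝ) 1, 0 ≤ f y / y := fun y hy =>
    div_nonneg (hfnonneg y ⟨ha0.trans_lt hy.1, hy.2⟩) (ha0.trans hy.1.le)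
  have hF0 : 0 ≤ F := by
    have := intervalIntegral.integral_mono_on_of_le_Ioo (f := fun _ => (0:ℝ)) ha1
      intervalIntegrable_const hfint hpt
    rw [intervalIntegral.integral_zero] at this
    exact this
  have hθh0 : ∀ j, 0 ≤ θhat j := fun j => by
    rw [hθhat]
    exact Finset.sum_nonneg fun u _ => mul_nonneg (hη0 j u)
      (Finset.sum_nonneg fun v _ => hθ u v)
  -- detailed balance representation
  have hrep : ∀ j u v, ∃ b : ℝ, 0 ≤ b ∧ η j u * θ u v = b * (1 / omegaSel (γ j u v)) ∧
      η j v * θ v u = b * (1 / omegaSel (-(γ j u v))) := by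
    intro j u v
    have w1 := aux_omega_pos (γ j u v)
    have w2 := aux_omega_pos (-(γ j u v))
    refine ⟨η j u * θ u v * omegaSel (γ j u v),
      mul_nonneg (mul_nonneg (hη0 j u) (hθ u v)) w1.le, ?_, ?_⟩
    · field_simp
    · rw [hdb, hγ j v u]
      field_simp
  have hΩ1 : ∀ j, 1 ≤ Ω j := by
    intro j
    rw [hΩ]
    have : 0 ≤ ∑ u, ∑ v, η j u * θ u v * (1 + Real.log N + Ksel (γ j u v)) := by
      apply aux_sym
      intro u v
      obtain ⟨b, hb, h1, h2⟩ := hrep j u v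
      rw [h1, h2, hγ j v u]
      have hle : 4 * (γ j u v) ^ 2 ≤ (N : ℝ) := by
        have := sq_le_sq' (by linarith [neg_abs_le (γ j u v), hC j u v] : -C ≤ γ j u v)
          ((le_abs_self _).trans (hC j u v))
        linarith
      have := mul_nonneg hb (aux_K (γ j u v) N hNr hle)
      linarith
    have h2 : 0 ≤ (2 / (L:ℝ)) := by positivity
    linarith [mul_nonneg h2 this]
  constructor
  · have hj : ∀ j, (∑ u, ∑ v, (2 * η j u * θ u v / (L * Ω j)) *
        ∫ y in (1 / N : ℝ)..1, (f y / y) * (omegaSel (γ j u v) * Jfun (γ j u v) y))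
        ≤ 2 * ((1 / L) * (θhat j / Ω j)) * F := by
      intro j
      have hΩ0 : 0 < Ω j := by linarith [hΩ1 j]
      have hs : 0 ≤ ∑ u, ∑ v, η j u * θ u v * (F -
          ∫ y in (1 / N : ℝ)..1, (f y / y) * (omegaSel (γ j u v) * Jfun (γ j u v) y)) := by
        apply aux_sym
        intro u v
        obtain ⟨b, hb, h1, h2⟩ := hrep j u v
        rw [h1, h2, hγ j v u]
        generalize γ j u v = c
        have w1 := (aux_omega_pos c).ne'
        have w2 := (aux_omega_pos (-c)).ne'
        have ex : ∀ c : ℝ, ∫ y in (1 / N : ℝ)..1, (f y / y) * (omegaSel c * Jfun c y)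
            = omegaSel c * ∫ y in (1 / N : ℝ)..1, (f y / y) * Jfun c y := by
          intro c
          rw [← intervalIntegral.integral_const_mul]
          congr 1
          ext y
          ring
        have hi := fun c => aux_J_int (fun y => f y / y) _ ha0 ha1 hfint c
        have hle : (∫ y in (1 / N : ℝ)..1, (f y / y) * Jfun c y)
            + (∫ y in (1 / N : ℝ)..1, (f y / y) * Jfun (-c) y)
            ≤ F * (1 / omegaSel c + 1 / omegaSel (-c)) := by
          rw [← intervalIntegral.integral_add (hi c) (hi (-c)), hF,
            ← intervalIntegral.integral_mul_const]
          apply intervalIntegral.integral_mono_on_of_le_Ioo ha1 ((hi c).add (hi (-c)))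
            (hfint.mul_const _)
          intro y hy
          have := mul_le_mul_of_nonneg_left
            (aux_J_le c y (ha0.trans hy.1.le) hy.2.le) (hpt y hy)
          linarith
        rw [ex, ex]
        have e : b * (1 / omegaSel c) * (F - omegaSel c * ∫ y in (1 / N : ℝ)..1, (f y / y) * Jfun c y)
          + b * (1 / omegaSel (-c)) * (F - omegaSel (-c) * ∫ y in (1 / N : ℝ)..1, (f y / y) * Jfun (-c) y)
          = b * (F * (1 / omegaSel c + 1 / omegaSel (-c)) -
            ((∫ y in (1 / N : ℝ)..1, (f y / y) * Jfun c y)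
            + (∫ y in (1 / N : ℝ)..1, (f y / y) * Jfun (-c) y))) := by
          generalize (∫ y in (1 / N : ℝ)..1, (f y / y) * Jfun c y) = A
          generalize (∫ y in (1 / N : ℝ)..1, (f y / y) * Jfun (-c) y) = B
          field_simp
          ring
        rw [e]
        exact mul_nonneg hb (sub_nonneg.2 hle)
      have hk : 0 ≤ 2 / (L * Ω j) := by positivity
      have hm := mul_nonneg hk hs
      have e : 2 / (L * Ω j) * ∑ u, ∑ v, η j u * θ u v * (F -
          ∫ y in (1 / N : ℝ)..1, (f y / y) * (omegaSel (γ j u v) * Jfun (γ j u v) y))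
          = 2 * ((1 / L) * (θhat j / Ω j)) * F - ∑ u, ∑ v, (2 * η j u * θ u v / (L * Ω j)) *
        ∫ y in (1 / N : ℝ)..1, (f y / y) * (omegaSel (γ j u v) * Jfun (γ j u v) y) := by
        have e1 : 2 * ((1 / L) * (θhat j / Ω j)) * F
            = ∑ u, ∑ v, (2 / (L * Ω j)) * (η j u * θ u v * F) := by
          rw [hθhat]
          simp only [← Finset.mul_sum, ← Finset.sum_mul]
          field_simp
        rw [e1, ← Finset.sum_sub_distrib, Finset.mul_sum]
        refine Finset.sum_congr rfl fun u _ => ?_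
        rw [← Finset.sum_sub_distrib, Finset.mul_sum]
        refine Finset.sum_congr rfl fun v _ => ?_
        ring
      linarith
    refine (Finset.sum_le_sum fun j _ => hj j).trans (le_of_eq ?_)
    rw [hθeff, Finset.mul_sum, Finset.mul_sum, Finset.sum_mul]
  · apply mul_le_mul_of_nonneg_right _ hF0
    rw [hθeff, hθbar]
    have : ∑ j, θhat j / Ω j ≤ ∑ j, θhat j :=
      Finset.sum_le_sum fun j _ => div_le_self (hθh0 j) (hΩ1 j)
    gcongr
end
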